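/- For every n ≥ 3, the number of triangulations of the convex n-gon equals the Catalan number C_{n−2}. -/

import Mathlib

/-- `x` lies strictly inside the (clockwise) open arc from `a` to `b` on the convex `n`-gon
whose vertices are identified with `ZMod n` in cyclic order. -/
def Between (n : ℕ) (a x b : ZMod n) : Prop :=
  0 < (x - a).val ∧ (x - a).val < (b - a).val

/-- A diagonal of the convex `n`-gon: an unordered pair of distinct, non cyclically adjacent
vertices. -/
def IsDiagonal (n : ℕ) (p : Sym2 (ZMod n)) : Prop :=
  ∃ a b : ZMod n, p = s(a, b) ∧ a ≠ b ∧ b ≠ a + 1 ∧ b ≠ a - 1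

/-- Two diagonals cross iff their endpoints interleave in cyclic order: for some labelings
`p = {a,b}`, `q = {c,d}`, the vertex `c` lies strictly inside the arc from `a` to `b` and
`d` lies strictly inside the arc from `b` to `a`. -/
def Cross (n : ℕ) (p q : Sym2 (ZMod n)) : Prop :=
  ∃ a b c d : ZMod n, p = s(a, b) ∧ q = s(c, d) ∧ Between n a c b ∧ Between n b d a

/-- A triangulation of the convex `n`-gon: a set of `n − 3` pairwise non-crossing diagonals. -/
def IsTriangulation (n : ℕ) (T : Finset (Sym2 (ZMod n))) : Prop :=
  T.card = n - 3 ∧ (∀ p ∈ T, IsDiagonal n p) ∧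
    ∀ p ∈ T, ∀ q ∈ T, p ≠ q → ¬ Cross n p q

/-- The span-2 diagonal `e_i = {i−1, i+1}`. -/
def spanTwo (n : ℕ) (i : ZMod n) : Sym2 (ZMod n) := s(i - 1, i + 1)

/-- `T(n,m)`: the number of triangulations of the convex `n`-gon containing none of the span-2
diagonals `e_1, …, e_m`. -/
noncomputable def Tcount (n m : ℕ) : ℕ :=
  Set.ncard {T : Finset (Sym2 (ZMod n)) |
    IsTriangulation n T ∧ ∀ k : ℕ, 1 ≤ k → k ≤ m → spanTwo n (k : ZMod n) ∉ T}

/-- `F` is a set of pairwise non-crossing chords `(i, j)` of the integer interval `[a, b]`, each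
joining two vertices at distance at least two. The chord `(a, b)` itself is allowed. -/
def IsNoncrossingOn (a b : ℕ) (F : Finset (ℕ × ℕ)) : Prop :=
  (∀ p ∈ F, a ≤ p.1 ∧ p.1 + 2 ≤ p.2 ∧ p.2 ≤ b) ∧
    ∀ p ∈ F, ∀ q ∈ F, ¬ (p.1 < q.1 ∧ q.1 < p.2 ∧ p.2 < q.2)

theorem IsNoncrossingOn.filter_mem_interval {a b : ℕ} {F : Finset (ℕ × ℕ)}
    (h : IsNoncrossingOn a b F) (c d : ℕ) :
    IsNoncrossingOn c d (F.filter fun p => c ≤ p.1 ∧ p.2 ≤ d) := by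
  refine ⟨fun p hp => ?_, fun p hp q hq => ?_⟩
  · rw [Finset.mem_filter] at hp
    have := h.1 p hp.1
    omega
  · exact h.2 p (Finset.mem_filter.1 hp).1 q (Finset.mem_filter.1 hq).1

/-- A non-crossing family splits at an inner vertex `c`, up to the chord `(a, b)`. -/
theorem IsNoncrossingOn.exists_split {a b : ℕ} {F : Finset (ℕ × ℕ)}
    (h : IsNoncrossingOn a b F) (hab : a + 2 ≤ b) :
    ∃ c, a < c ∧ c < b ∧ F.erase (a, b) =
      (F.filter fun p => a ≤ p.1 ∧ p.2 ≤ c) ∪ F.filter fun p => c ≤ p.1 ∧ p.2 ≤ b := by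
  classical
  set P : ℕ → Prop := fun c => a < c ∧ c < b ∧ (c = a + 1 ∨ (a, c) ∈ F) with hP
  have hP1 : P (a + 1) := ⟨by omega, by omega, Or.inl rfl⟩
  have hc : P (Nat.findGreatest P b) := Nat.findGreatest_spec (by omega) hP1
  have hmax : ∀ d, P d → d ≤ Nat.findGreatest P b := fun d hd =>
    Nat.le_findGreatest hd.2.1.le hd
  generalize Nat.findGreatest P b = c at hc hmax
  refine ⟨c, hc.1, hc.2.1, ?_⟩
  ext ⟨i, j⟩
  simp only [Finset.mem_erase, Finset.mem_union, Finset.mem_filter, ne_eq, Prod.mk.injEq]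
  constructor
  · rintro ⟨hne, hF⟩
    have hij := h.1 _ hF
    simp only at hij
    by_contra hcon
    have hlt : i < c ∧ c < j := by
      by_contra h'
      exact hcon (by by_cases hjc : j ≤ c
                     · exact Or.inl ⟨hF, hij.1, hjc⟩
                     · exact Or.inr ⟨hF, by omega, hij.2.2⟩)
    rcases hij.1.eq_or_lt with rfl | hai
    · have := hmax j ⟨by omega, by omega, Or.inr hF⟩
      omega
    · rcases hc.2.2 with rfl | hcF
      · omega
      · exact h.2 _ hcF _ hF ⟨hai, hlt⟩
  · rintro (⟨hF, h1, h2⟩ | ⟨hF, h1, h2⟩)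
    · exact ⟨fun hh => by have := hc.2.1; omega, hF⟩
    · exact ⟨fun hh => by have := hc.1; omega, hF⟩

theorem IsNoncrossingOn.card_le {a b : ℕ} {F : Finset (ℕ × ℕ)}
    (h : IsNoncrossingOn a b F) : F.card ≤ b - a - 1 := by
  induction hm : b - a using Nat.strong_induction_on generalizing a b F with
  | _ m ih =>
    subst hm
    by_cases hab : a + 2 ≤ b
    · obtain ⟨c, hac, hcb, hc⟩ := h.exists_split hab
      have h1 := ih (c - a) (by omega) (h.filter_mem_interval a c) rfl
      have h2 := ih (b - c) (by omega) (h.filter_mem_interval c b) rfl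
      have h3 := Finset.card_union_le (F.filter fun p => a ≤ p.1 ∧ p.2 ≤ c)
        (F.filter fun p => c ≤ p.1 ∧ p.2 ≤ b)
      have h4 := F.pred_card_le_card_erase (a := (a, b))
      rw [← hc] at h3
      omega
    · have : F = ∅ := Finset.eq_empty_of_forall_notMem fun p hp => by
        have := h.1 p hp
        omega
      simp [this]

/-- The chord sets of triangulations of the convex polygon with vertices `a, a + 1, …, b`, the
root side `(a, b)` being counted as a chord. -/
noncomputable def rootedTriangulations (a b : ℕ) : Finset (Finset (ℕ × ℕ)) := by
  classical
  exact (Finset.Icc a b ×ˢ Finset.Icc a b).powerset.filter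
    fun F => IsNoncrossingOn a b F ∧ F.card = b - a - 1

theorem mem_rootedTriangulations {a b : ℕ} {F : Finset (ℕ × ℕ)} :
    F ∈ rootedTriangulations a b ↔ IsNoncrossingOn a b F ∧ F.card = b - a - 1 := by
  classical
  simp only [rootedTriangulations, Finset.mem_filter, Finset.mem_powerset, and_iff_right_iff_imp]
  rintro ⟨h, -⟩ p hp
  have := h.1 p hp
  simp only [Finset.mem_product, Finset.mem_Icc]
  omega

theorem root_mem_of_mem_rootedTriangulations {a b : ℕ} {F : Finset (ℕ × ℕ)}
    (hF : F ∈ rootedTriangulations a b) (hab : a + 2 ≤ b) : (a, b) ∈ F := by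
  obtain ⟨h, hcard⟩ := mem_rootedTriangulations.1 hF
  by_contra hroot
  obtain ⟨c, hac, hcb, hc⟩ := h.exists_split hab
  have h1 := (h.filter_mem_interval a c).card_le
  have h2 := (h.filter_mem_interval c b).card_le
  have h3 := Finset.card_union_le (F.filter fun p => a ≤ p.1 ∧ p.2 ≤ c)
    (F.filter fun p => c ≤ p.1 ∧ p.2 ≤ b)
  rw [← hc, Finset.erase_eq_of_notMem hroot] at h3
  omega

/-- Glue triangulations of the two sides of the triangle on the root side `(a, b)`. -/
def glueChords (a b : ℕ) (x : Finset (ℕ × ℕ) × Finset (ℕ × ℕ)) : Finset (ℕ × ℕ) :=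
  insert (a, b) (x.1 ∪ x.2)

theorem glueChords_mem {a b c : ℕ} (hac : a < c) (hcb : c < b)
    {x : Finset (ℕ × ℕ) × Finset (ℕ × ℕ)}
    (hx : x ∈ rootedTriangulations a c ×ˢ rootedTriangulations c b) :
    glueChords a b x ∈ rootedTriangulations a b := by
  obtain ⟨F, G⟩ := x
  simp only [Finset.mem_product, mem_rootedTriangulations] at hx
  obtain ⟨⟨hF, hFc⟩, hG, hGc⟩ := hx
  have hdisj : Disjoint F G := Finset.disjoint_left.2 fun p hp hq => by
    have := hF.1 p hp
    have := hG.1 p hq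
    omega
  have hroot : (a, b) ∉ F ∪ G := by
    intro hmem
    rcases Finset.mem_union.1 hmem with hp | hp
    · have := hF.1 _ hp
      simp only at this
      omega
    · have := hG.1 _ hp
      simp only at this
      omega
  refine mem_rootedTriangulations.2 ⟨⟨?_, ?_⟩, ?_⟩
  · intro p hp
    simp only [glueChords, Finset.mem_insert, Finset.mem_union] at hp
    rcases hp with rfl | hp | hp
    · simp only
      omega
    · have := hF.1 p hp
      omega
    · have := hG.1 p hp
      omega
  · intro p hp q hq
    simp only [glueChords, Finset.mem_insert, Finset.mem_union] at hp hq
    rcases hp with rfl | hp | hp <;> rcases hq with rfl | hq | hq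
    · simp
    · have := hF.1 q hq
      simp only
      omega
    · have := hG.1 q hq
      simp only
      omega
    · have := hF.1 p hp
      simp only
      omega
    · exact hF.2 p hp q hq
    · have := hF.1 p hp
      have := hG.1 q hq
      omega
    · have := hG.1 p hp
      simp only
      omega
    · have := hG.1 p hp
      have := hF.1 q hq
      omega
    · exact hG.2 p hp q hq
  · rw [glueChords, Finset.card_insert_of_notMem hroot, Finset.card_union_of_disjoint hdisj]
    simp only [hFc, hGc]
    omega

theorem exists_glueChords_eq {a b : ℕ} {F : Finset (ℕ × ℕ)}
    (hF : F ∈ rootedTriangulations a b) (hab : a + 2 ≤ b) :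
    ∃ c ∈ Finset.Ioo a b, ∃ x ∈ rootedTriangulations a c ×ˢ rootedTriangulations c b,
      glueChords a b x = F := by
  have hroot := root_mem_of_mem_rootedTriangulations hF hab
  obtain ⟨h, hcard⟩ := mem_rootedTriangulations.1 hF
  obtain ⟨c, hac, hcb, hc⟩ := h.exists_split hab
  have h1 := h.filter_mem_interval a c
  have h2 := h.filter_mem_interval c b
  have h3 := Finset.card_union_le (F.filter fun p => a ≤ p.1 ∧ p.2 ≤ c)
    (F.filter fun p => c ≤ p.1 ∧ p.2 ≤ b)
  rw [← hc, Finset.card_erase_of_mem hroot] at h3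
  have h1' := h1.card_le
  have h2' := h2.card_le
  refine ⟨c, Finset.mem_Ioo.2 ⟨hac, hcb⟩,
    (F.filter fun p => a ≤ p.1 ∧ p.2 ≤ c, F.filter fun p => c ≤ p.1 ∧ p.2 ≤ b), Finset.mem_product.2
    ⟨mem_rootedTriangulations.2 ⟨h1, ?_⟩, mem_rootedTriangulations.2 ⟨h2, ?_⟩⟩, ?_⟩
  · simp only
    omega
  · simp only
    omega
  · rw [glueChords, ← hc, Finset.insert_erase hroot]

theorem glueChords_injOn {a b c : ℕ} (hac : a < c) (hcb : c < b) :
    Set.InjOn (glueChords a b)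
      (rootedTriangulations a c ×ˢ rootedTriangulations c b : Finset _) := by
  have key : ∀ x ∈ rootedTriangulations a c ×ˢ rootedTriangulations c b,
      x.1 = (glueChords a b x).filter (fun p => p.2 ≤ c) ∧
        x.2 = (glueChords a b x).filter (fun p => c ≤ p.1) := by
    rintro ⟨F, G⟩ hx
    simp only [Finset.mem_product, mem_rootedTriangulations] at hx
    obtain ⟨⟨hF, -⟩, hG, -⟩ := hx
    constructor <;> ext p <;>
      simp only [glueChords, Finset.mem_filter, Finset.mem_insert, Finset.mem_union] <;>
      constructor
    · exact fun hp => ⟨Or.inr (Or.inl hp), (hF.1 p hp).2.2⟩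
    · rintro ⟨rfl | hp | hp, hpc⟩
      · simp only at hpc
        omega
      · exact hp
      · have := hG.1 p hp
        omega
    · exact fun hp => ⟨Or.inr (Or.inr hp), (hG.1 p hp).1⟩
    · rintro ⟨rfl | hp | hp, hpc⟩
      · simp only at hpc
        omega
      · have := hF.1 p hp
        omega
      · exact hp
  intro x hx y hy hxy
  obtain ⟨hx1, hx2⟩ := key x hx
  obtain ⟨hy1, hy2⟩ := key y hy
  rw [hxy] at hx1 hx2
  exact Prod.ext (hx1.trans hy1.symm) (hx2.trans hy2.symm)

theorem glueChords_ne_of_lt {a b c d : ℕ} (hac : a < c) (hcd : c < d) (hdb : d < b)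
    {x y : Finset (ℕ × ℕ) × Finset (ℕ × ℕ)}
    (hx : x ∈ rootedTriangulations a c ×ˢ rootedTriangulations c b)
    (hy : y ∈ rootedTriangulations a d ×ˢ rootedTriangulations d b) :
    glueChords a b x ≠ glueChords a b y := by
  intro hxy
  have hmem : (a, d) ∈ glueChords a b y := Finset.mem_insert_of_mem <| Finset.mem_union_left _ <|
    root_mem_of_mem_rootedTriangulations (Finset.mem_product.1 hy).1 (by omega)
  simp only [Finset.mem_product, mem_rootedTriangulations] at hx
  rw [← hxy] at hmem
  simp only [glueChords, Finset.mem_insert, Finset.mem_union, Prod.mk.injEq] at hmem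
  rcases hmem with hp | hp | hp
  · omega
  · have := hx.1.1.1 _ hp
    simp only at this
    omega
  · have := hx.2.1.1 _ hp
    simp only at this
    omega

theorem card_rootedTriangulations (m a : ℕ) :
    (rootedTriangulations a (a + m + 1)).card = catalan m := by
  classical
  induction m using Nat.strong_induction_on generalizing a with
  | _ m ih =>
    rcases m with _ | m
    · have : rootedTriangulations a (a + 0 + 1) = {∅} := by
        ext F
        simp only [mem_rootedTriangulations, Finset.mem_singleton]
        constructor
        · rintro ⟨-, hF⟩
          exact Finset.card_eq_zero.1 (by omega)
        · rintro rfl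
          exact ⟨⟨by simp, by simp⟩, by simp⟩
      simp [this]
    · set b := a + (m + 1) + 1 with hb
      have hU : rootedTriangulations a b = (Finset.Ioo a b).biUnion fun c =>
          (rootedTriangulations a c ×ˢ rootedTriangulations c b).image (glueChords a b) := by
        ext F
        simp only [Finset.mem_biUnion, Finset.mem_image]
        constructor
        · exact fun hF => exists_glueChords_eq hF (by omega)
        · rintro ⟨c, hc, x, hx, rfl⟩
          rw [Finset.mem_Ioo] at hc
          exact glueChords_mem hc.1 hc.2 hx
      rw [hU, Finset.card_biUnion]
      · rw [catalan_succ, ← Finset.sum_range fun i => catalan i * catalan (m - i)]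
        symm
        refine Finset.sum_bij (fun i _ => a + i + 1) ?_ ?_ ?_ ?_
        · intro i hi
          simp only [Finset.mem_range, Finset.mem_Ioo] at hi ⊢
          omega
        · intro i _ j _ hij
          omega
        · intro c hc
          rw [Finset.mem_Ioo] at hc
          exact ⟨c - a - 1, by simp only [Finset.mem_range]; omega, by omega⟩
        · intro i hi
          rw [Finset.mem_range] at hi
          rw [Finset.card_image_of_injOn (glueChords_injOn (by omega) (by omega)),
            Finset.card_product, ih i (by omega) a,
            show b = a + i + 1 + (m - i) + 1 by omega, ih (m - i) (by omega)]
      · intro c hc d hd hcd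
        rw [SetLike.mem_coe, Finset.mem_Ioo] at hc hd
        rw [Function.onFun, Finset.disjoint_left]
        intro F hFc hFd
        obtain ⟨x, hx, rfl⟩ := Finset.mem_image.1 hFc
        obtain ⟨y, hy, hxy⟩ := Finset.mem_image.1 hFd
        rcases lt_or_gt_of_ne hcd with hlt | hlt
        · exact glueChords_ne_of_lt hc.1 hlt hd.2 hx hy hxy.symm
        · exact glueChords_ne_of_lt hd.1 hlt hc.2 hy hx hxy

/-- The diagonal of the `n`-gon with the given endpoints. -/
def chordToDiagonal (n : ℕ) (p : ℕ × ℕ) : Sym2 (ZMod n) := s((p.1 : ZMod n), (p.2 : ZMod n))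

/-- The endpoints of a pair of vertices, as natural numbers in increasing order. -/
def diagonalToChord (n : ℕ) : Sym2 (ZMod n) → ℕ × ℕ :=
  Sym2.lift ⟨fun a b => (min a.val b.val, max a.val b.val), fun a b => by
    simp only [min_comm, max_comm]⟩

@[simp]
theorem diagonalToChord_mk (n : ℕ) (a b : ZMod n) :
    diagonalToChord n s(a, b) = (min a.val b.val, max a.val b.val) := rfl

theorem chordToDiagonal_diagonalToChord (n : ℕ) [NeZero n] (p : Sym2 (ZMod n)) :
    chordToDiagonal n (diagonalToChord n p) = p := by
  induction p with
  | _ a b =>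
    rcases le_total a.val b.val with h | h
    · simp [chordToDiagonal, h]
    · simp [chordToDiagonal, h, Sym2.eq_swap]

theorem diagonalToChord_chordToDiagonal {n : ℕ} {p : ℕ × ℕ} (h : p.1 ≤ p.2) (hn : p.2 < n) :
    diagonalToChord n (chordToDiagonal n p) = p := by
  simp [chordToDiagonal, ZMod.val_natCast, Nat.mod_eq_of_lt hn, Nat.mod_eq_of_lt (h.trans_lt hn), h]

theorem diagonalToChord_injective (n : ℕ) [NeZero n] : Function.Injective (diagonalToChord n) :=
  Function.LeftInverse.injective (chordToDiagonal_diagonalToChord n)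

theorem ZMod.val_sub_eq_ite {n : ℕ} [NeZero n] (a b : ZMod n) :
    (a - b).val = if b.val ≤ a.val then a.val - b.val else n + a.val - b.val := by
  have ha := ZMod.val_lt a
  have hb := ZMod.val_lt b
  split_ifs with h
  · exact ZMod.val_sub h
  · have hba : (b - a).val = b.val - a.val := ZMod.val_sub (by omega)
    have hne : b - a ≠ 0 := fun h0 => by
      rw [h0, ZMod.val_zero] at hba
      omega
    have := NeZero.mk hne
    rw [← neg_sub, ZMod.val_neg_of_ne_zero, hba]
    omega

theorem isDiagonal_iff {n : ℕ} (hn : 3 ≤ n) (p : Sym2 (ZMod n)) :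
    IsDiagonal n p ↔ (diagonalToChord n p).1 + 2 ≤ (diagonalToChord n p).2 ∧
      diagonalToChord n p ≠ (0, n - 1) := by
  have : NeZero n := ⟨by omega⟩
  have : Fact (1 < n) := ⟨by omega⟩
  have key : ∀ a b : ZMod n, (a ≠ b ∧ b ≠ a + 1 ∧ b ≠ a - 1) ↔
      (min a.val b.val + 2 ≤ max a.val b.val ∧
        ¬ (min a.val b.val = 0 ∧ max a.val b.val = n - 1)) := by
    intro a b
    have ha := ZMod.val_lt a
    have hb := ZMod.val_lt b
    have h1 : b = a + 1 ↔ (b - a).val = 1 := by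
      rw [← sub_eq_iff_eq_add', ← (ZMod.val_injective n).eq_iff, ZMod.val_one]
    have h2 : b = a - 1 ↔ (a - b).val = 1 := by
      rw [eq_sub_iff_add_eq, eq_comm, ← sub_eq_iff_eq_add', ← (ZMod.val_injective n).eq_iff,
        ZMod.val_one]
    rw [ne_eq, ne_eq, ne_eq, h1, h2, ← (ZMod.val_injective n).eq_iff, ZMod.val_sub_eq_ite,
      ZMod.val_sub_eq_ite]
    split_ifs <;> omega
  constructor
  · rintro ⟨a, b, rfl, h⟩
    simpa using (key a b).1 h
  · induction p with
    | _ a b =>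
      intro h
      exact ⟨a, b, rfl, (key a b).2 (by simpa using h)⟩

theorem exists_mk_of_val_le {n : ℕ} (p : Sym2 (ZMod n)) :
    ∃ a b : ZMod n, a.val ≤ b.val ∧ p = s(a, b) := by
  induction p with
  | _ a b =>
    rcases le_total a.val b.val with h | h
    · exact ⟨a, b, h, rfl⟩
    · exact ⟨b, a, h, Sym2.eq_swap⟩

theorem diagonalToChord_snd_lt {n : ℕ} [NeZero n] (p : Sym2 (ZMod n)) :
    (diagonalToChord n p).2 < n := by
  induction p with
  | _ a b => exact max_lt (ZMod.val_lt a) (ZMod.val_lt b)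

theorem cross_iff {n : ℕ} [NeZero n] (p q : Sym2 (ZMod n)) :
    Cross n p q ↔
      ((diagonalToChord n p).1 < (diagonalToChord n q).1 ∧
        (diagonalToChord n q).1 < (diagonalToChord n p).2 ∧
        (diagonalToChord n p).2 < (diagonalToChord n q).2) ∨
      ((diagonalToChord n q).1 < (diagonalToChord n p).1 ∧
        (diagonalToChord n p).1 < (diagonalToChord n q).2 ∧
        (diagonalToChord n q).2 < (diagonalToChord n p).2) := by
  constructor
  · rintro ⟨a, b, c, d, rfl, rfl, h1, h2⟩
    have ha := ZMod.val_lt a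
    have hb := ZMod.val_lt b
    have hc := ZMod.val_lt c
    have hd := ZMod.val_lt d
    simp only [Between, ZMod.val_sub_eq_ite] at h1 h2
    simp only [diagonalToChord_mk]
    split_ifs at h1 h2 <;> omega
  · obtain ⟨a, b, hab, rfl⟩ := exists_mk_of_val_le p
    obtain ⟨c, d, hcd, rfl⟩ := exists_mk_of_val_le q
    have ha := ZMod.val_lt a
    have hb := ZMod.val_lt b
    have hc := ZMod.val_lt c
    have hd := ZMod.val_lt d
    simp only [diagonalToChord_mk, min_eq_left hab, max_eq_right hab, min_eq_left hcd,
      max_eq_right hcd]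
    rintro (h | h)
    · refine ⟨a, b, c, d, rfl, rfl, ?_, ?_⟩ <;> simp only [Between, ZMod.val_sub_eq_ite] <;>
        split_ifs <;> omega
    · refine ⟨a, b, d, c, rfl, Sym2.eq_swap, ?_, ?_⟩ <;>
        simp only [Between, ZMod.val_sub_eq_ite] <;> split_ifs <;> omega

/-- The triangulation of the `n`-gon obtained by forgetting the root side. -/
def toTriangulation (n : ℕ) (F : Finset (ℕ × ℕ)) : Finset (Sym2 (ZMod n)) :=
  (F.erase (0, n - 1)).image (chordToDiagonal n)

/-- The chord set of a triangulation of the `n`-gon, together with the root side. -/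
def toRootedTriangulation (n : ℕ) (T : Finset (Sym2 (ZMod n))) : Finset (ℕ × ℕ) :=
  insert (0, n - 1) (T.image (diagonalToChord n))

theorem toRootedTriangulation_toTriangulation {n : ℕ} (hn : 3 ≤ n) {F : Finset (ℕ × ℕ)}
    (hF : F ∈ rootedTriangulations 0 (n - 1)) :
    toRootedTriangulation n (toTriangulation n F) = F := by
  have hroot := root_mem_of_mem_rootedTriangulations hF (by omega)
  have h : (F.erase (0, n - 1)).image (diagonalToChord n ∘ chordToDiagonal n) =
      F.erase (0, n - 1) := by
    refine (Finset.image_congr fun p hp => ?_).trans Finset.image_id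
    have := (mem_rootedTriangulations.1 hF).1.1 p (Finset.mem_of_mem_erase hp)
    exact diagonalToChord_chordToDiagonal (by omega) (by omega)
  rw [toRootedTriangulation, toTriangulation, Finset.image_image, h, Finset.insert_erase hroot]

theorem IsTriangulation.root_notMem {n : ℕ} (hn : 3 ≤ n) {T : Finset (Sym2 (ZMod n))}
    (hT : IsTriangulation n T) : (0, n - 1) ∉ T.image (diagonalToChord n) := by
  intro h
  obtain ⟨p, hp, hpr⟩ := Finset.mem_image.1 h
  exact ((isDiagonal_iff hn p).1 (hT.2.1 p hp)).2 hpr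

theorem toTriangulation_toRootedTriangulation {n : ℕ} (hn : 3 ≤ n) {T : Finset (Sym2 (ZMod n))}
    (hT : IsTriangulation n T) : toTriangulation n (toRootedTriangulation n T) = T := by
  have : NeZero n := ⟨by omega⟩
  have h : chordToDiagonal n ∘ diagonalToChord n = id :=
    funext (chordToDiagonal_diagonalToChord n)
  rw [toTriangulation, toRootedTriangulation, Finset.erase_insert (hT.root_notMem hn),
    Finset.image_image, h, Finset.image_id]

theorem IsTriangulation.toRootedTriangulation_mem {n : ℕ} (hn : 3 ≤ n)
    {T : Finset (Sym2 (ZMod n))} (hT : IsTriangulation n T) :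
    toRootedTriangulation n T ∈ rootedTriangulations 0 (n - 1) := by
  have : NeZero n := ⟨by omega⟩
  refine mem_rootedTriangulations.2 ⟨⟨?_, ?_⟩, ?_⟩
  · intro p hpi
    rcases Finset.mem_insert.1 hpi with rfl | hpi
    · simp only
      omega
    · obtain ⟨p, hp, rfl⟩ := Finset.mem_image.1 hpi
      have h1 := ((isDiagonal_iff hn p).1 (hT.2.1 p hp)).1
      have h2 := diagonalToChord_snd_lt p
      omega
  · intro p hpi q hqi
    rcases Finset.mem_insert.1 hpi with rfl | hpi
    · rcases Finset.mem_insert.1 hqi with rfl | hqi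
      · simp
      · obtain ⟨q, hq, rfl⟩ := Finset.mem_image.1 hqi
        have := diagonalToChord_snd_lt q
        simp only
        omega
    · rcases Finset.mem_insert.1 hqi with rfl | hqi
      · simp
      · obtain ⟨p, hp, rfl⟩ := Finset.mem_image.1 hpi
        obtain ⟨q, hq, rfl⟩ := Finset.mem_image.1 hqi
        by_cases hpq : p = q
        · subst hpq
          simp
        · exact fun h => hT.2.2 p hp q hq hpq ((cross_iff p q).2 (Or.inl h))
  · rw [toRootedTriangulation, Finset.card_insert_of_notMem (hT.root_notMem hn),
      Finset.card_image_of_injective _ (diagonalToChord_injective n), hT.1]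
    omega

theorem isTriangulation_toTriangulation {n : ℕ} (hn : 3 ≤ n) {F : Finset (ℕ × ℕ)}
    (hF : F ∈ rootedTriangulations 0 (n - 1)) : IsTriangulation n (toTriangulation n F) := by
  have : NeZero n := ⟨by omega⟩
  have hroot := root_mem_of_mem_rootedTriangulations hF (by omega)
  obtain ⟨h, hcard⟩ := mem_rootedTriangulations.1 hF
  have hinv : ∀ p ∈ F.erase (0, n - 1), diagonalToChord n (chordToDiagonal n p) = p := by
    intro p hp
    have := h.1 p (Finset.mem_of_mem_erase hp)
    exact diagonalToChord_chordToDiagonal (by omega) (by omega)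
  refine ⟨?_, ?_, ?_⟩
  · rw [toTriangulation, Finset.card_image_of_injOn (Set.LeftInvOn.injOn hinv),
      Finset.card_erase_of_mem hroot, hcard]
    omega
  · intro p hpi
    obtain ⟨p, hp, rfl⟩ := Finset.mem_image.1 hpi
    rw [isDiagonal_iff hn, hinv p hp]
    exact ⟨(h.1 p (Finset.mem_of_mem_erase hp)).2.1, Finset.ne_of_mem_erase hp⟩
  · intro p hpi q hqi _
    obtain ⟨p, hp, rfl⟩ := Finset.mem_image.1 hpi
    obtain ⟨q, hq, rfl⟩ := Finset.mem_image.1 hqi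
    rw [cross_iff, hinv p hp, hinv q hq]
    rintro (hc | hc)
    · exact h.2 p (Finset.mem_of_mem_erase hp) q (Finset.mem_of_mem_erase hq) hc
    · exact h.2 q (Finset.mem_of_mem_erase hq) p (Finset.mem_of_mem_erase hp) hc

/-- For `n ≥ 3`, the number of triangulations of the convex `n`-gon is the Catalan number
`C_{n−2}`. -/
theorem card_triangulations_eq_catalan (n : ℕ) (hn : 3 ≤ n) :
    Set.ncard {T : Finset (Sym2 (ZMod n)) | IsTriangulation n T} = catalan (n - 2) := by
  have h : {T : Finset (Sym2 (ZMod n)) | IsTriangulation n T} =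
      toTriangulation n '' (rootedTriangulations 0 (n - 1)) := by
    ext T
    constructor
    · exact fun hT => ⟨_, IsTriangulation.toRootedTriangulation_mem hn hT,
        toTriangulation_toRootedTriangulation hn hT⟩
    · rintro ⟨F, hF, rfl⟩
      exact isTriangulation_toTriangulation hn hF
  have hinj : Set.InjOn (toTriangulation n) (rootedTriangulations 0 (n - 1)) :=
    Set.LeftInvOn.injOn fun _ hF => toRootedTriangulation_toTriangulation hn hF
  rw [h, hinj.ncard_image, Set.ncard_coe_finset,
    show n - 1 = 0 + (n - 2) + 1 by omega, card_rootedTriangulations]
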